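/- Let P, Q ⊂ ℝ^n be rational polytopes such that P ⊕ Q is a free sum. Then the Ehrhart series identity Ehr_{P⊕Q}(t) = (1 − t)·Ehr_P(t)·Ehr_Q(t) holds in ℤ[[t]] — equivalently, for every integer k ≥ 0, L_{P⊕Q}(k) = Σ_{i=0}^{k} L_P(i)·L_Q(k−i) − Σ_{i=0}^{k−1} L_P(i)·L_Q(k−1−i) — if and only if P^∨ is a lattice polyhedron or Q^∨ is a lattice polyhedron. -/

import Mathlib

open Set Pointwise
open scoped Classical

noncomputable section

namespace ArxivFreeSum

/-- A point of `ℝ^m` is an integer lattice point iff all coordinates are integers. -/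
def IsLat {m : ℕ} (x : Fin m → ℝ) : Prop := ∀ i, ∃ z : ℤ, x i = (z : ℝ)

/-- The set of integer lattice points of a set `S`. -/
def latt {m : ℕ} (S : Set (Fin m → ℝ)) : Set (Fin m → ℝ) := {x | x ∈ S ∧ IsLat x}

variable {n : ℕ}

/-- The affine embedding `α : ℝ^n → ℝ^{n+1}`, `a ↦ (a, 1)`. -/
def emb (a : Fin n → ℝ) : Fin (n + 1) → ℝ := Fin.snoc a 1

/-- The cone over `K`: all nonnegative multiples of `α(K)`. -/
def cone (K : Set (Fin n → ℝ)) : Set (Fin (n + 1) → ℝ) :=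
  {x | ∃ l : ℝ, ∃ a ∈ K, 0 ≤ l ∧ x = l • emb a}

/-- The last standard basis vector `e_{n+1}` of `ℝ^{n+1}`. -/
def eLast (n : ℕ) : Fin (n + 1) → ℝ := Pi.single (Fin.last n) 1

/-- The vertical projection `ε_J` onto the lower envelope of `cone J`. -/
def eps (J : Set (Fin n → ℝ)) (x : Fin (n + 1) → ℝ) : Fin (n + 1) → ℝ :=
  x - sSup {l : ℝ | x - l • eLast n ∈ cone J} • eLast n

/-- The lower envelope of `cone J`. -/
def lenv (J : Set (Fin n → ℝ)) : Set (Fin (n + 1) → ℝ) := eps J '' cone J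

/-- The lower lattice envelope of `cone J`. -/
def llenv (J : Set (Fin n → ℝ)) : Set (Fin (n + 1) → ℝ) := eps J '' latt (cone J)

/-- `J ⊕ K` is a free sum. -/
def IsFreeSum (J K : Set (Fin n → ℝ)) : Prop :=
  (0 : Fin n → ℝ) ∈ J ∧ (0 : Fin n → ℝ) ∈ K ∧
    ∀ m : Fin n → ℝ, m ∈ Submodule.span ℝ (J ∪ K) → IsLat m →
      ∃! q : (Fin n → ℝ) × (Fin n → ℝ),
        (q.1 ∈ Submodule.span ℝ J ∧ IsLat q.1) ∧
        (q.2 ∈ Submodule.span ℝ K ∧ IsLat q.2) ∧ m = q.1 + q.2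

/-- `N_{J,K}(m)`: the number of pairs of lattice points of `cone J` and `cone K` summing
to `m`. -/
def Npairs (J K : Set (Fin n → ℝ)) (m : Fin (n + 1) → ℤ) : ℕ :=
  Set.ncard {q : (Fin (n + 1) → ℝ) × (Fin (n + 1) → ℝ) |
    q.1 ∈ latt (cone J) ∧ q.2 ∈ latt (cone K) ∧ q.1 + q.2 = fun i => (m i : ℝ)}

/-- The coefficientwise form of the multivariate Braun equation
`σ_{cone(J⊕K)} = (1 - z_{n+1}) σ_{cone J} σ_{cone K}`. -/
def BraunEq (J K : Set (Fin n → ℝ)) : Prop :=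
  ∀ m : Fin (n + 1) → ℤ,
    (Npairs J K m : ℤ) - (Npairs J K (m - Pi.single (Fin.last n) 1) : ℤ) =
      if (fun i => (m i : ℝ)) ∈ cone (convexHull ℝ (J ∪ K)) then 1 else 0

/-- A rational polytope: convex hull of finitely many rational points. -/
def IsRatPolytope (P : Set (Fin n → ℝ)) : Prop :=
  ∃ V : Finset (Fin n → ℝ), (∀ v ∈ V, ∀ i, ∃ q : ℚ, v i = (q : ℝ)) ∧
    P = convexHull ℝ (V : Set (Fin n → ℝ))

/-- A lattice polytope: convex hull of finitely many lattice points. -/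
def IsLatPolytope (P : Set (Fin n → ℝ)) : Prop :=
  ∃ V : Finset (Fin n → ℝ), (∀ v ∈ V, IsLat v) ∧ P = convexHull ℝ (V : Set (Fin n → ℝ))

/-- The polar dual `P^∨ ⊆ (lin P)^*` of a polytope `P` containing the origin. -/
def dualSet (P : Set (Fin n → ℝ)) : Set (Module.Dual ℝ (Submodule.span ℝ P)) :=
  {φ | ∀ a : Submodule.span ℝ P, (a : Fin n → ℝ) ∈ P → φ a ≤ 1}

/-- Membership in the dual integer lattice `(lin P)^*_ℤ`. -/
def IsDualLatticePt (P : Set (Fin n → ℝ)) (φ : Module.Dual ℝ (Submodule.span ℝ P)) : Prop :=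
  ∀ a : Submodule.span ℝ P, IsLat (a : Fin n → ℝ) → ∃ z : ℤ, φ a = (z : ℝ)

/-- `P^∨` is a lattice polyhedron: every vertex (= extreme point) of `P^∨` lies in the
dual integer lattice. -/
def DualIsLatticePolyhedron (P : Set (Fin n → ℝ)) : Prop :=
  ∀ φ ∈ Set.extremePoints ℝ (dualSet P), IsDualLatticePt P φ

/-- `den(P^∨)`: the smallest positive integer `d` such that `d • P^∨` is a lattice
polyhedron. -/
def dualDen (P : Set (Fin n → ℝ)) : ℕ :=
  sInf {d : ℕ | 0 < d ∧ ∀ φ ∈ Set.extremePoints ℝ (dualSet P), IsDualLatticePt P ((d : ℝ) • φ)}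

/-- `L_P(k)`, with `L_P(0) = 1`. -/
def ehr (P : Set (Fin n → ℝ)) (k : ℕ) : ℕ :=
  if k = 0 then 1 else Set.ncard (latt ((k : ℝ) • P))

/-- The coefficientwise form of `Ehr_{P⊕Q}(t) = (1-t) Ehr_P(t) Ehr_Q(t)`. -/
def EhrEq (P Q : Set (Fin n → ℝ)) : Prop :=
  ∀ k : ℕ,
    (ehr (convexHull ℝ (P ∪ Q)) k : ℤ) =
      (∑ i ∈ Finset.range (k + 1), (ehr P i : ℤ) * (ehr Q (k - i) : ℤ)) -
        ∑ i ∈ Finset.range k, (ehr P i : ℤ) * (ehr Q (k - 1 - i) : ℤ)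

/-- `P` is reflexive: a lattice polytope containing the origin in its relative interior
whose polar dual is a lattice polytope. -/
def IsReflexive (P : Set (Fin n → ℝ)) : Prop :=
  IsLatPolytope P ∧ (0 : Fin n → ℝ) ∈ intrinsicInterior ℝ P ∧ DualIsLatticePolyhedron P

/-- `P` is Gorenstein of index `k`. -/
def IsGorenstein (P : Set (Fin n → ℝ)) (k : ℕ) : Prop :=
  IsLatPolytope P ∧ 0 < k ∧
    ∃ m : Fin n → ℝ, IsLat m ∧ IsReflexive ((fun x => x - m) '' ((k : ℝ) • P))

/-- `p` is a rational point. -/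
def IsRatPt (p : Fin n → ℝ) : Prop := ∀ i, ∃ q : ℚ, p i = (q : ℝ)

/-- Membership in the lattice `Λ^p` generated by `e_1, …, e_n` and `p`. -/
def InLambda (p x : Fin n → ℝ) : Prop :=
  ∃ (z : Fin n → ℤ) (c : ℤ), x = (fun i => (z i : ℝ)) + (c : ℝ) • p

/-- `den(p)`: the lcm of the denominators of the coordinates of `p`, i.e. the least
positive integer `r` with `r • p` a lattice point. -/
def denPt (p : Fin n → ℝ) : ℕ := sInf {r : ℕ | 0 < r ∧ IsLat ((r : ℝ) • p)}

/-- The projection `ε^p_J` parallel to `α(p)` onto the `p`-lower envelope of `cone J`. -/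
def epsP (p : Fin n → ℝ) (J : Set (Fin n → ℝ)) (x : Fin (n + 1) → ℝ) : Fin (n + 1) → ℝ :=
  x - sSup {l : ℝ | x - l • emb p ∈ cone J} • emb p

/-- The `p`-lower envelope of `cone J`. -/
def plenv (p : Fin n → ℝ) (J : Set (Fin n → ℝ)) : Set (Fin (n + 1) → ℝ) := epsP p J '' cone J

/-- The `p`-lower lattice envelope of `cone J`. -/
def pllenv (p : Fin n → ℝ) (J : Set (Fin n → ℝ)) : Set (Fin (n + 1) → ℝ) :=
  epsP p J '' latt (cone J)

/-- `J ⊕ K` is an affine free sum with common (rational) point `p`. -/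
def IsAffineFreeSum (J K : Set (Fin n → ℝ)) (p : Fin n → ℝ) : Prop :=
  IsRatPt p ∧ p ∈ J ∧ p ∈ K ∧
    ((affineSpan ℝ J : Set (Fin n → ℝ)) ∩ (affineSpan ℝ K : Set (Fin n → ℝ)) = {p}) ∧
    ∀ m : Fin n → ℝ, m ∈ Submodule.span ℝ ((fun x => x - p) '' (J ∪ K)) → InLambda p m →
      ∃! q : (Fin n → ℝ) × (Fin n → ℝ),
        (q.1 ∈ Submodule.span ℝ ((fun x => x - p) '' J) ∧ InLambda p q.1) ∧
        (q.2 ∈ Submodule.span ℝ ((fun x => x - p) '' K) ∧ InLambda p q.2) ∧ m = q.1 + q.2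


theorem improve {E : Type*} [AddCommGroup E] [Module ℝ E] {ι : Type*} [Fintype ι]
    (v : ι → E) (hsp : Submodule.span ℝ (Set.range v) = ⊤) (c : ι → ℝ) (hc : ∀ i, 0 ≤ c i)
    (x : E) (hx : x = ∑ i, c i • v i) :
    ∀ (N : ℕ) (φ0 : Module.Dual ℝ E), (∀ i, φ0 (v i) ≤ 1) →
      (Finset.univ.filter (fun i => φ0 (v i) < 1)).card = N →
      ∃ φ : Module.Dual ℝ E, (∀ i, φ (v i) ≤ 1) ∧
        Submodule.span ℝ (v '' {i | φ (v i) = 1}) = ⊤ ∧ φ0 x ≤ φ x := by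
  intro N
  induction N using Nat.strong_induction_on with
  | _ N ih =>
  intro φ0 h0 hN
  by_cases hT : Submodule.span ℝ (v '' {i | φ0 (v i) = 1}) = ⊤
  · exact ⟨φ0, h0, hT, le_rfl⟩
  obtain ⟨ψ, hψ0, hψ⟩ := Submodule.exists_le_ker_of_lt_top _ (lt_top_iff_ne_top.mpr hT)
  have key : ∃ ψ : Module.Dual ℝ E, (∀ i, φ0 (v i) = 1 → ψ (v i) = 0) ∧ 0 ≤ ψ x ∧
      ∃ i, 0 < ψ (v i) := by
    have ht : ∀ i, φ0 (v i) = 1 → ψ (v i) = 0 := fun i hi =>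
      hψ (Submodule.subset_span ⟨i, hi, rfl⟩)
    have pos : ∀ χ : Module.Dual ℝ E, 0 < χ x → ∃ i, 0 < χ (v i) := by
      intro χ h
      by_contra! hcon
      have : χ x ≤ 0 := by
        rw [hx, map_sum]
        apply Finset.sum_nonpos
        intro i _
        rw [map_smul, smul_eq_mul]
        exact mul_nonpos_of_nonneg_of_nonpos (hc i) (hcon i)
      linarith
    rcases lt_trichotomy (ψ x) 0 with h | h | h
    · refine ⟨-ψ, fun i hi => by simp [ht i hi], by simp; linarith, pos _ (by simpa using h)⟩
    · have : ∃ i, ψ (v i) ≠ 0 := by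
        by_contra! hcon
        apply hψ0
        apply LinearMap.ext_on_range hsp
        intro i; simp [hcon i]
      obtain ⟨i, hi⟩ := this
      rcases lt_or_gt_of_ne hi with hi | hi
      · exact ⟨-ψ, fun i hi => by simp [ht i hi], by simp [h], i, by simpa using hi⟩
      · exact ⟨ψ, ht, h.ge, i, hi⟩
    · exact ⟨ψ, ht, h.le, pos _ h⟩
  clear hψ hψ0 ψ
  obtain ⟨ψ, ht, hψx, j, hj⟩ := key
  obtain ⟨i0, hi0, hmin⟩ := Finset.exists_min_image
    (Finset.univ.filter (fun i => 0 < ψ (v i))) (fun i => (1 - φ0 (v i)) / ψ (v i))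
    ⟨j, by simpa using hj⟩
  have hp0 : 0 < ψ (v i0) := by simpa using hi0
  set t := (1 - φ0 (v i0)) / ψ (v i0) with htdef
  have ht0 : 0 ≤ t := div_nonneg (by linarith [h0 i0]) hp0.le
  have hle : ∀ i, (φ0 + t • ψ) (v i) ≤ 1 := by
    intro i
    simp only [LinearMap.add_apply, LinearMap.smul_apply, smul_eq_mul]
    by_cases hi : 0 < ψ (v i)
    · have := hmin i (by simpa using hi)

      rw [le_div_iff₀ hi] at this
      linarith
    · have := mul_nonpos_of_nonneg_of_nonpos ht0 (not_lt.mp hi)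
      linarith [h0 i]
  have heq0 : (φ0 + t • ψ) (v i0) = 1 := by
    simp only [LinearMap.add_apply, LinearMap.smul_apply, smul_eq_mul, htdef]
    field_simp; ring
  have hlt : φ0 (v i0) < 1 := lt_of_le_of_ne (h0 i0) (fun h => hp0.ne' (ht i0 h))
  have hcard : (Finset.univ.filter (fun i => (φ0 + t • ψ) (v i) < 1)).card < N := by
    rw [← hN]
    apply Finset.card_lt_card
    rw [Finset.ssubset_iff_of_subset]
    · refine ⟨i0, by simpa using hlt, ?_⟩
      simp only [Finset.mem_filter, Finset.mem_univ, true_and, heq0, lt_irrefl, not_false_eq_true]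
    · intro i hi
      simp only [Finset.mem_filter, Finset.mem_univ, true_and] at hi ⊢
      refine lt_of_le_of_ne (h0 i) fun h => ?_
      simp [h, ht i h] at hi
  obtain ⟨φ, h1, h2, h3⟩ := ih _ hcard _ hle rfl
  refine ⟨φ, h1, h2, le_trans ?_ h3⟩
  simp only [LinearMap.add_apply, LinearMap.smul_apply, smul_eq_mul]
  have := mul_nonneg ht0 hψx
  linarith

theorem extreme_of_tight {E : Type*} [AddCommGroup E] [Module ℝ E] {ι : Type*}
    (v : ι → E) (φ : Module.Dual ℝ E) (h : ∀ i, φ (v i) ≤ 1)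
    (hT : Submodule.span ℝ (v '' {i | φ (v i) = 1}) = ⊤) :
    φ ∈ Set.extremePoints ℝ {φ : Module.Dual ℝ E | ∀ i, φ (v i) ≤ 1} := by
  rw [mem_extremePoints_iff_left]
  refine ⟨h, ?_⟩
  intro φ1 h1 φ2 h2 hseg
  obtain ⟨a, b, ha, hb, hab, rfl⟩ := hseg
  apply LinearMap.ext_on hT
  rintro _ ⟨i, hi, rfl⟩
  have e1 := h1 i
  have e2 := h2 i
  simp only [mem_ofPred_eq, LinearMap.add_apply, LinearMap.smul_apply, smul_eq_mul] at hi ⊢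
  rw [hi]
  have : a * (1 - φ1 (v i)) + b * (1 - φ2 (v i)) = 0 := by linear_combination hab - hi
  nlinarith [mul_nonneg ha.le (sub_nonneg.mpr e1), mul_nonneg hb.le (sub_nonneg.mpr e2)]

theorem tight_of_extreme {E : Type*} [AddCommGroup E] [Module ℝ E] {ι : Type*} [Fintype ι]
    (v : ι → E) (φ : Module.Dual ℝ E)
    (hφ : φ ∈ Set.extremePoints ℝ {φ : Module.Dual ℝ E | ∀ i, φ (v i) ≤ 1}) :
    Submodule.span ℝ (v '' {i | φ (v i) = 1}) = ⊤ := by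
  rw [mem_extremePoints_iff_left] at hφ
  obtain ⟨h0, hext⟩ := hφ
  simp only [mem_ofPred_eq] at h0
  by_contra hT
  obtain ⟨ψ, hψ0, hψ⟩ := Submodule.exists_le_ker_of_lt_top _ (lt_top_iff_ne_top.mpr hT)
  have ht : ∀ i, φ (v i) = 1 → ψ (v i) = 0 := fun i hi =>
      hψ (Submodule.subset_span ⟨i, hi, rfl⟩)
  have hev : ∀ᶠ t in nhdsWithin (0:ℝ) (Set.Ioi 0), ∀ i, φ (v i) + t * |ψ (v i)| ≤ 1 := by
    rw [Filter.eventually_all]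
    intro i
    rcases (h0 i).lt_or_eq with h | h
    · have hc : Filter.Tendsto (fun t : ℝ => φ (v i) + t * |ψ (v i)|) (nhds 0)
          (nhds (φ (v i) + 0 * |ψ (v i)|)) := by
        apply Continuous.tendsto
        fun_prop
      have := hc.eventually_lt_const (u := 1) (by simpa using h)
      exact (this.filter_mono nhdsWithin_le_nhds).mono fun t h => h.le
    · exact Filter.Eventually.of_forall fun t => by simp [h, ht i h]
  obtain ⟨t, htt, htpos⟩ := (hev.and self_mem_nhdsWithin).exists
  have htpos : 0 < t := htpos
  have := hext (φ + t • ψ) (by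
    intro i
    simp only [LinearMap.add_apply, LinearMap.smul_apply, smul_eq_mul]
    have := mul_le_mul_of_nonneg_left (le_abs_self (ψ (v i))) htpos.le
    linarith [htt i]) (φ - t • ψ) (by
    intro i
    simp only [LinearMap.sub_apply, LinearMap.smul_apply, smul_eq_mul]
    have := mul_le_mul_of_nonneg_left (neg_abs_le (ψ (v i))) htpos.le
    linarith [htt i]) ⟨1/2, 1/2, by norm_num, by norm_num, by norm_num, by module⟩
  have h2 : t • ψ = 0 := by simpa using this
  rcases smul_eq_zero.mp h2 with h | h
  · exact htpos.ne' h
  · exact hψ0 h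
/-- the gauge -/
def gg (P : Set (Fin n → ℝ)) (x : Fin n → ℝ) : ℝ := sInf {l : ℝ | 0 ≤ l ∧ x ∈ l • P}

/-- the (unlifted) cone -/
def cn (P : Set (Fin n → ℝ)) : Set (Fin n → ℝ) := {x | ∃ l : ℝ, 0 ≤ l ∧ x ∈ l • P}

theorem smul_mono' {P : Set (Fin n → ℝ)} (hc : Convex ℝ P) (h0 : (0 : Fin n → ℝ) ∈ P)
    {a b : ℝ} (ha : 0 ≤ a) (hab : a ≤ b) {x : Fin n → ℝ} (hx : x ∈ a • P) : x ∈ b • P := by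
  obtain ⟨p, hp, rfl⟩ := hx
  rcases hab.eq_or_lt with rfl | hlt
  · exact ⟨p, hp, rfl⟩
  have hb : 0 < b := lt_of_le_of_lt ha hlt
  refine ⟨(a / b) • p, hc.smul_mem_of_zero_mem h0 hp ⟨div_nonneg ha hb.le, (div_le_one hb).mpr hab⟩, ?_⟩
  simp only [smul_smul]
  rw [mul_div_cancel₀ _ hb.ne']

theorem gg_isLeast {P : Set (Fin n → ℝ)} (hK : IsCompact P) (hc : Convex ℝ P)
    (h0 : (0 : Fin n → ℝ) ∈ P) {x : Fin n → ℝ} (hx : x ∈ cn P) :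
    IsLeast {l : ℝ | 0 ≤ l ∧ x ∈ l • P} (gg P x) := by
  obtain ⟨R, hR, hxR⟩ := hx
  have hcomp : IsCompact (Prod.fst '' ((Set.Icc (0:ℝ) R ×ˢ P) ∩ {q : ℝ × (Fin n → ℝ) | q.1 • q.2 = x})) := by
    apply IsCompact.image _ continuous_fst
    apply IsCompact.inter_right
    · exact isCompact_Icc.prod hK
    · exact isClosed_eq (by fun_prop) continuous_const
  have hne : (Prod.fst '' ((Set.Icc (0:ℝ) R ×ˢ P) ∩ {q : ℝ × (Fin n → ℝ) | q.1 • q.2 = x})).Nonempty := by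
    obtain ⟨p, hp, hpx⟩ := hxR
    exact ⟨R, (R, p), ⟨⟨⟨hR, le_rfl⟩, hp⟩, hpx⟩, rfl⟩
  obtain ⟨g, hg, hgl⟩ := hcomp.exists_isLeast hne
  obtain ⟨⟨g', p⟩, ⟨⟨⟨hg0, hgR⟩, hp⟩, hpx⟩, rfl⟩ := hg
  have hL : IsLeast {l : ℝ | 0 ≤ l ∧ x ∈ l • P} g' := by
    refine ⟨⟨hg0, p, hp, hpx⟩, ?_⟩
    rintro l ⟨hl0, q, hq, hqx⟩
    by_cases hlR : l ≤ R
    · exact hgl ⟨(l, q), ⟨⟨⟨hl0, hlR⟩, hq⟩, hqx⟩, rfl⟩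
    · exact hgR.trans (not_le.mp hlR).le
  unfold gg
  rw [hL.csInf_eq]
  exact hL

theorem gg_nonneg {P : Set (Fin n → ℝ)} (x : Fin n → ℝ) : 0 ≤ gg P x :=
  Real.sInf_nonneg fun _ h => h.1

theorem mem_smul_iff {P : Set (Fin n → ℝ)} (hK : IsCompact P) (hc : Convex ℝ P)
    (h0 : (0 : Fin n → ℝ) ∈ P) {x : Fin n → ℝ} {l : ℝ} (hl : 0 ≤ l) :
    x ∈ l • P ↔ x ∈ cn P ∧ gg P x ≤ l := by
  constructor
  · intro h
    have hx : x ∈ cn P := ⟨l, hl, h⟩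
    exact ⟨hx, (gg_isLeast hK hc h0 hx).2 ⟨hl, h⟩⟩
  · rintro ⟨hx, h⟩
    have := (gg_isLeast hK hc h0 hx).1
    exact smul_mono' hc h0 this.1 h this.2

theorem cn_smul {P : Set (Fin n → ℝ)} {x : Fin n → ℝ} (hx : x ∈ cn P) {j : ℝ} (hj : 0 ≤ j) :
    j • x ∈ cn P := by
  obtain ⟨l, hl, p, hp, rfl⟩ := hx
  exact ⟨j * l, mul_nonneg hj hl, p, hp, by simp [smul_smul]⟩

theorem gg_smul {P : Set (Fin n → ℝ)} (hK : IsCompact P) (hc : Convex ℝ P)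
    (h0 : (0 : Fin n → ℝ) ∈ P) {x : Fin n → ℝ} (hx : x ∈ cn P) {j : ℝ} (hj : 0 < j) :
    gg P (j • x) = j * gg P x := by
  have h1 := gg_isLeast hK hc h0 hx
  have h2 := gg_isLeast hK hc h0 (cn_smul hx hj.le)
  apply le_antisymm
  · apply h2.2
    refine ⟨mul_nonneg hj.le h1.1.1, ?_⟩
    obtain ⟨p, hp, hpx⟩ := h1.1.2
    exact ⟨p, hp, by simp only at hpx ⊢; rw [mul_smul, hpx]⟩
  · have : gg P x ≤ j⁻¹ * gg P (j • x) := by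
      apply h1.2
      refine ⟨mul_nonneg (inv_nonneg.mpr hj.le) h2.1.1, ?_⟩
      obtain ⟨p, hp, hpx⟩ := h2.1.2
      refine ⟨p, hp, ?_⟩
      simp only at hpx ⊢
      rw [mul_smul, hpx, smul_smul, inv_mul_cancel₀ hj.ne', one_smul]
    calc j * gg P x ≤ j * (j⁻¹ * gg P (j • x)) := mul_le_mul_of_nonneg_left this hj.le
      _ = _ := by rw [← mul_assoc, mul_inv_cancel₀ hj.ne', one_mul]

theorem IsLat.add {m : ℕ} {x y : Fin m → ℝ} (hx : IsLat x) (hy : IsLat y) : IsLat (x + y) := by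
  intro i
  obtain ⟨a, ha⟩ := hx i
  obtain ⟨b, hb⟩ := hy i
  exact ⟨a + b, by simp [ha, hb]⟩

theorem IsLat.zsmul {m : ℕ} {x : Fin m → ℝ} (hx : IsLat x) (z : ℤ) : IsLat ((z : ℝ) • x) := by
  intro i
  obtain ⟨a, ha⟩ := hx i
  exact ⟨z * a, by simp [ha]⟩

theorem exists_den {m : ℕ} (x : Fin m → ℝ) (h : ∀ i, ∃ q : ℚ, x i = q) :
    ∃ d : ℕ, 0 < d ∧ IsLat ((d : ℝ) • x) := by
  choose q hq using h
  refine ⟨∏ i, (q i).den, Finset.prod_pos fun i _ => (q i).den_pos, fun i => ?_⟩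
  have hd : (q i).den ∣ ∏ i, (q i).den := Finset.dvd_prod_of_mem _ (Finset.mem_univ i)
  obtain ⟨e, he⟩ := hd
  refine ⟨e * (q i).num, ?_⟩
  rw [he, Pi.smul_apply, hq, smul_eq_mul]
  have h1 : (((q i).den : ℚ) : ℝ) * (q i : ℝ) = ((q i).num : ℚ) := by
    rw [← Rat.cast_mul]; congr 1; exact Rat.den_mul_eq_num (q i)
  push_cast at h1 ⊢
  linear_combination (e : ℝ) * h1

theorem latt_finite {m : ℕ} {S : Set (Fin m → ℝ)} (hS : Bornology.IsBounded S) :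
    (latt S).Finite := by
  obtain ⟨R, hR⟩ := hS.exists_norm_le
  have hf : (Set.pi Set.univ (fun _ : Fin m => (fun z : ℤ => (z : ℝ)) '' Set.Icc (-⌈R⌉) ⌈R⌉)).Finite :=
    Set.Finite.pi fun _ => (Set.finite_Icc _ _).image _
  refine hf.subset ?_
  rintro x ⟨hxS, hx⟩ i _
  obtain ⟨z, hz⟩ := hx i
  refine ⟨z, ?_, hz.symm⟩
  have h1 : |x i| ≤ R := (norm_le_pi_norm x i).trans (hR x hxS)
  rw [hz] at h1
  have h2 : |(z : ℝ)| ≤ ⌈R⌉ := h1.trans (Int.le_ceil R)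
  rw [abs_le] at h2
  exact ⟨by exact_mod_cast h2.1, by exact_mod_cast h2.2⟩

theorem rat_stable (lam : ℝ →ₗ[ℚ] ℚ) {S : Set (Fin n → ℝ)}
    (hS : ∀ v ∈ S, ∀ i, ∃ q : ℚ, v i = q) {x : Fin n → ℝ} (hx : x ∈ Submodule.span ℝ S) :
    ∀ c : ℝ, (fun i => ((lam (c * x i) : ℚ) : ℝ)) ∈ Submodule.span ℝ S := by
  induction hx using Submodule.span_induction with
  | mem v hv =>
    intro c
    have : (fun i => ((lam (c * v i) : ℚ) : ℝ)) = ((lam c : ℚ) : ℝ) • v := by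
      funext i
      obtain ⟨q, hq⟩ := hS v hv i
      have : c * (q : ℝ) = q • c := by rw [Rat.smul_def, mul_comm]
      rw [Pi.smul_apply, hq, this, map_smul]
      simp [mul_comm]
    rw [this]
    exact Submodule.smul_mem _ _ (Submodule.subset_span hv)
  | zero =>
    intro c
    have h := (Submodule.span ℝ S).zero_mem
    convert h using 1
    funext i
    simp
  | add x y _ _ hx hy =>
    intro c
    have := Submodule.add_mem _ (hx c) (hy c)
    convert this using 1
    funext i
    simp [mul_add]
  | smul a x _ hx =>
    intro c
    have := hx (c * a)
    simpa [mul_assoc] using this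

theorem span_disjoint {P Q : Set (Fin n → ℝ)} {VP VQ : Set (Fin n → ℝ)}
    (hVP : ∀ v ∈ VP, ∀ i, ∃ q : ℚ, v i = q) (hVQ : ∀ v ∈ VQ, ∀ i, ∃ q : ℚ, v i = q)
    (hP : Submodule.span ℝ P = Submodule.span ℝ VP)
    (hQ : Submodule.span ℝ Q = Submodule.span ℝ VQ) (hfree : IsFreeSum P Q)
    {x : Fin n → ℝ} (hxP : x ∈ Submodule.span ℝ P) (hxQ : x ∈ Submodule.span ℝ Q) : x = 0 := by
  by_contra hx
  obtain ⟨k, hk⟩ : ∃ k, x k ≠ 0 := by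
    by_contra! h
    exact hx (funext h)
  obtain ⟨lam, hlam⟩ : ∃ lam : ℝ →ₗ[ℚ] ℚ, lam (x k) ≠ 0 := by
    by_contra! h
    exact hk ((Module.forall_dual_apply_eq_zero_iff ℚ (x k)).mp h)
  set y : Fin n → ℝ := fun i => ((lam (x i) : ℚ) : ℝ) with hy
  have hyP : y ∈ Submodule.span ℝ P := by
    rw [hP] at hxP ⊢
    simpa using rat_stable lam hVP hxP 1
  have hyQ : y ∈ Submodule.span ℝ Q := by
    rw [hQ] at hxQ ⊢
    simpa using rat_stable lam hVQ hxQ 1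
  obtain ⟨d, hd, hdl⟩ := exists_den y fun i => ⟨_, rfl⟩
  obtain ⟨q, _, huniq⟩ := hfree.2.2 0 (Submodule.zero_mem _) (fun i => ⟨0, by simp⟩)
  have h1 := huniq (0, 0) ⟨⟨Submodule.zero_mem _, fun i => ⟨0, by simp⟩⟩,
    ⟨Submodule.zero_mem _, fun i => ⟨0, by simp⟩⟩, by simp⟩
  have h2 := huniq ((d : ℝ) • y, -((d : ℝ) • y)) ⟨⟨Submodule.smul_mem _ _ hyP, hdl⟩,
    ⟨Submodule.neg_mem _ (Submodule.smul_mem _ _ hyQ), by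
      have := hdl.zsmul (-1)
      simpa using this⟩, by simp⟩
  have h3 : (d : ℝ) • y = 0 := by
    have := congrArg Prod.fst (h2.trans h1.symm)
    simpa using this
  have h4 := congrFun h3 k
  simp only [Pi.smul_apply, smul_eq_mul, Pi.zero_apply, hy, mul_eq_zero, Nat.cast_eq_zero,
    Rat.cast_eq_zero] at h4
  rcases h4 with h | h
  · omega
  · exact hlam h
theorem count_eq {α β : Type*} (A : Set α) (B : Set β) (a : α → ℕ) (b : β → ℕ)
    (hA : ∀ k, {x | x ∈ A ∧ a x ≤ k}.Finite) (hB : ∀ k, {y | y ∈ B ∧ b y ≤ k}.Finite) (k : ℕ) :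
    ({q : α × β | q.1 ∈ A ∧ q.2 ∈ B ∧ a q.1 + b q.2 ≤ k}.ncard : ℤ) =
      (∑ i ∈ Finset.range (k + 1), ({x | x ∈ A ∧ a x ≤ i}.ncard : ℤ) *
          ({y | y ∈ B ∧ b y ≤ k - i}.ncard : ℤ)) -
        ∑ i ∈ Finset.range k, ({x | x ∈ A ∧ a x ≤ i}.ncard : ℤ) *
          ({y | y ∈ B ∧ b y ≤ k - 1 - i}.ncard : ℤ) := by
  have hBe : ∀ k, {y | y ∈ B ∧ b y = k}.Finite := fun k =>
    (hB k).subset fun y hy => ⟨hy.1, hy.2.le⟩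
  have hN : {q : α × β | q.1 ∈ A ∧ q.2 ∈ B ∧ a q.1 + b q.2 ≤ k}.ncard =
      ∑ i ∈ Finset.range (k + 1), {x | x ∈ A ∧ a x ≤ i}.ncard * {y | y ∈ B ∧ b y = k - i}.ncard := by
    have hfin : {q : α × β | q.1 ∈ A ∧ q.2 ∈ B ∧ a q.1 + b q.2 ≤ k}.Finite := by
      refine ((hA k).prod (hB k)).subset ?_
      rintro ⟨x, y⟩ ⟨h1, h2, h3⟩
      simp only at h1 h2 h3
      exact ⟨⟨h1, by simp only; omega⟩, ⟨h2, by simp only; omega⟩⟩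
    rw [Set.ncard_eq_toFinset_card _ hfin,
      Finset.card_eq_sum_card_fiberwise (f := fun q => k - b q.2) (t := Finset.range (k + 1))]
    · apply Finset.sum_congr rfl
      intro i hi
      rw [Finset.mem_range] at hi
      rw [Set.ncard_eq_toFinset_card _ (hA i), Set.ncard_eq_toFinset_card _ (hBe (k - i)),
        ← Finset.card_product]
      congr 1
      ext ⟨x, y⟩
      simp only [Finset.mem_filter, Set.Finite.mem_toFinset, Set.mem_ofPred_eq, Finset.mem_product]
      constructor
      · rintro ⟨⟨h1, h2, h3⟩, h4⟩
        exact ⟨⟨h1, by omega⟩, h2, by omega⟩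
      · rintro ⟨⟨h1, h2⟩, h3, h4⟩
        exact ⟨⟨h1, h3, by omega⟩, by omega⟩
    · intro q hq
      simp only [Finset.coe_range, Set.mem_Iio]
      omega
  have hl0 : {y | y ∈ B ∧ b y = 0}.ncard = {y | y ∈ B ∧ b y ≤ 0}.ncard := by
    congr 1; ext y; simp
  have hls : ∀ j, ({y | y ∈ B ∧ b y = j + 1}.ncard : ℤ) =
      {y | y ∈ B ∧ b y ≤ j + 1}.ncard - {y | y ∈ B ∧ b y ≤ j}.ncard := by
    intro j
    have : {y | y ∈ B ∧ b y ≤ j + 1} = {y | y ∈ B ∧ b y ≤ j} ∪ {y | y ∈ B ∧ b y = j + 1} := by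
      ext y
      simp only [Set.mem_ofPred_eq, Set.mem_union]
      constructor
      · rintro ⟨h1, h2⟩
        rcases Nat.lt_or_ge (b y) (j + 1) with h | h
        · exact Or.inl ⟨h1, by omega⟩
        · exact Or.inr ⟨h1, by omega⟩
      · rintro (⟨h1, h2⟩ | ⟨h1, h2⟩)
        · exact ⟨h1, by omega⟩
        · exact ⟨h1, by omega⟩
    rw [this, Set.ncard_union_eq _ (hB j) (hBe (j + 1))]
    · push_cast; ring
    · rw [Set.disjoint_left]
      rintro y ⟨_, h⟩ ⟨_, h'⟩
      omega
  rw [hN]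
  push_cast
  rw [Finset.sum_range_succ, Finset.sum_range_succ, Nat.sub_self, hl0, add_sub_right_comm,
    ← Finset.sum_sub_distrib]
  congr 1
  apply Finset.sum_congr rfl
  intro i hi
  rw [Finset.mem_range] at hi
  obtain ⟨j, rfl⟩ : ∃ j, k = i + j + 1 := ⟨k - i - 1, by omega⟩
  rw [show i + j + 1 - i = j + 1 by omega, show i + j + 1 - 1 - i = j by omega, hls]
  ring

theorem mem_smul_hull {V : Finset (Fin n → ℝ)} (h0 : (0 : Fin n → ℝ) ∈ convexHull ℝ (V : Set (Fin n → ℝ)))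
    {l : ℝ} (hl : 0 ≤ l) {x : Fin n → ℝ} :
    x ∈ l • convexHull ℝ (V : Set (Fin n → ℝ)) ↔
      ∃ c : V → ℝ, (∀ i, 0 ≤ c i) ∧ ∑ i, c i = l ∧ ∑ i, c i • (i : Fin n → ℝ) = x := by
  constructor
  · rintro ⟨p, hp, rfl⟩
    rw [Finset.mem_convexHull'] at hp
    obtain ⟨w, hw0, hw1, hwp⟩ := hp
    refine ⟨fun i => l * w i, fun i => mul_nonneg hl (hw0 _ i.2), ?_, ?_⟩
    · rw [← Finset.mul_sum, Finset.sum_coe_sort V w, hw1, mul_one]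
    · simp only [mul_smul]
      rw [← Finset.smul_sum, Finset.sum_coe_sort V (fun y => w y • y), hwp]
  · rintro ⟨c, hc, hcl, rfl⟩
    rcases hl.eq_or_lt with rfl | hlt
    · have : ∀ i, c i = 0 := by
        intro i
        exact (Finset.sum_eq_zero_iff_of_nonneg (fun i _ => hc i)).mp hcl i (Finset.mem_univ i)
      exact ⟨0, h0, by simp [this]⟩
    · refine ⟨∑ i, (l⁻¹ * c i) • (i : Fin n → ℝ), ?_, ?_⟩
      · apply (convex_convexHull ℝ _).sum_mem
        · intro i _; exact mul_nonneg (inv_nonneg.mpr hl) (hc i)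
        · rw [← Finset.mul_sum, hcl, inv_mul_cancel₀ hlt.ne']
        · intro i _; exact subset_convexHull ℝ _ i.2
      · simp only [mul_smul]
        rw [← Finset.smul_sum, smul_smul, mul_inv_cancel₀ hlt.ne', one_smul]

theorem int_iff {P : Set (Fin n → ℝ)} (hP : IsRatPolytope P) (h0 : (0 : Fin n → ℝ) ∈ P) :
    DualIsLatticePolyhedron P ↔ ∀ x ∈ cn P, IsLat x → ∃ z : ℤ, gg P x = z := by
  obtain ⟨V, hV, rfl⟩ := hP
  set P := convexHull ℝ (V : Set (Fin n → ℝ)) with hPdef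
  have hK : IsCompact P := V.finite_toSet.isCompact_convexHull (𝕜 := ℝ)
  have hc : Convex ℝ P := convex_convexHull ℝ _
  let v : V → Submodule.span ℝ P := fun i => ⟨i, Submodule.subset_span (subset_convexHull ℝ _ i.2)⟩
  have hcomb : ∀ (c : V → ℝ), ((∑ i, c i • v i : Submodule.span ℝ P) : Fin n → ℝ) =
      ∑ i, c i • (i : Fin n → ℝ) := by
    intro c
    rw [Submodule.coe_sum]
    rfl
  have hrep : ∀ (l : ℝ), 0 ≤ l → ∀ a : Submodule.span ℝ P, (a : Fin n → ℝ) ∈ l • P →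
      ∃ c : V → ℝ, (∀ i, 0 ≤ c i) ∧ ∑ i, c i = l ∧ a = ∑ i, c i • v i := by
    intro l hl a ha
    obtain ⟨c, h1, h2, h3⟩ := (mem_smul_hull h0 hl).mp ha
    exact ⟨c, h1, h2, Subtype.ext (by rw [hcomb, h3])⟩
  have hsp : Submodule.span ℝ (Set.range v) = ⊤ := by
    rw [eq_top_iff, ← Submodule.span_span_coe_preimage (R := ℝ) (s := P), Submodule.span_le]
    intro a ha
    obtain ⟨c, h1, h2, h3⟩ := hrep 1 zero_le_one a (by rw [one_smul]; exact ha)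
    rw [h3]
    exact Submodule.sum_mem _ fun i _ => Submodule.smul_mem _ _ (Submodule.subset_span ⟨i, rfl⟩)
  have hbd : ∀ φ : Module.Dual ℝ (Submodule.span ℝ P), (∀ i, φ (v i) ≤ 1) → ∀ l : ℝ, 0 ≤ l →
      ∀ a : Submodule.span ℝ P, (a : Fin n → ℝ) ∈ l • P → φ a ≤ l := by
    intro φ hφ l hl a ha
    obtain ⟨c, h1, h2, rfl⟩ := hrep l hl a ha
    rw [map_sum, ← h2]
    apply Finset.sum_le_sum
    intro i _
    rw [map_smul, smul_eq_mul]
    nlinarith [h1 i, hφ i]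
  have hdual : dualSet P = {φ | ∀ i, φ (v i) ≤ 1} := by
    ext φ
    constructor
    · intro h i
      exact h _ (subset_convexHull ℝ _ i.2)
    · intro h a ha
      exact hbd φ h 1 zero_le_one a (by rwa [one_smul])
  have hcnspan : ∀ x ∈ cn P, x ∈ Submodule.span ℝ P := by
    rintro x ⟨l, hl, p, hp, rfl⟩
    exact Submodule.smul_mem _ _ (Submodule.subset_span hp)
  constructor
  · intro hD x hx hxl
    have hL := gg_isLeast hK hc h0 hx
    set g := gg P x with hg
    have hg0 : 0 ≤ g := hL.1.1
    rcases hg0.eq_or_lt with hg0 | hgpos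
    · exact ⟨0, by simp [← hg0]⟩
    let X : Submodule.span ℝ P := ⟨x, hcnspan x hx⟩
    obtain ⟨c, hc0, hcs, hcx⟩ := hrep g hL.1.1 X hL.1.2
    -- for l < g there is a functional
    have sep : ∀ l : ℝ, 0 ≤ l → l < g → ∃ φ : Module.Dual ℝ (Submodule.span ℝ P),
        (∀ i, φ (v i) ≤ 1) ∧ l < φ X := by
      intro l hl hlg
      obtain ⟨l', hll', hl'g⟩ := exists_between hlg
      have hl'0 : 0 < l' := lt_of_le_of_lt hl hll'
      have hnot : l'⁻¹ • x ∉ P := by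
        intro h
        have := hL.2 ⟨hl'0.le, l'⁻¹ • x, h, by simp [smul_smul, hl'0.ne']⟩
        linarith
      obtain ⟨f, u, hfu, hux⟩ := geometric_hahn_banach_closed_point hc hK.isClosed hnot
      have hu : 0 < u := by simpa using hfu 0 h0
      refine ⟨u⁻¹ • (f.toLinearMap.comp (Submodule.span ℝ P).subtype), ?_, ?_⟩
      · intro i
        have := (hfu i (subset_convexHull ℝ _ i.2)).le
        change u⁻¹ * f i ≤ 1
        rw [inv_mul_le_iff₀ hu]; linarith
      · change l < u⁻¹ * f x
        rw [map_smul, smul_eq_mul, lt_inv_mul_iff₀ hl'0] at hux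
        rw [lt_inv_mul_iff₀ hu]
        nlinarith
    have hceil : ((⌈g⌉ - 1 : ℤ) : ℝ) < g := by
      push_cast
      linarith [Int.ceil_lt_add_one g]
    have hceil0 : (0 : ℝ) ≤ ((⌈g⌉ - 1 : ℤ) : ℝ) := by
      have : 0 < ⌈g⌉ := Int.ceil_pos.mpr hgpos
      exact_mod_cast (by omega : (0 : ℤ) ≤ ⌈g⌉ - 1)
    obtain ⟨φ0, hφ0, hlt⟩ := sep _ hceil0 hceil
    obtain ⟨φ, hφ, hT, hge⟩ := improve v hsp c hc0 X hcx _ φ0 hφ0 rfl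
    have hext := extreme_of_tight v φ hφ hT
    rw [← hdual] at hext
    obtain ⟨z, hz⟩ := hD φ hext X hxl
    have hle := hbd φ hφ g hL.1.1 X hL.1.2
    refine ⟨z, ?_⟩
    rw [hz] at hge hle
    have h1 : ⌈g⌉ - 1 < z := by exact_mod_cast hlt.trans_le hge
    have h2 : (⌈g⌉ : ℝ) ≤ z := by exact_mod_cast (by omega : ⌈g⌉ ≤ z)
    linarith [Int.le_ceil g]
  · intro hI φ hφ a ha
    rw [hdual] at hφ
    have hT := tight_of_extreme v φ hφ
    have hle : ∀ i, φ (v i) ≤ 1 := hφ.1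
    set T : Set V := {i | φ (v i) = 1} with hTdef
    -- φ is integral on lattice points of the cone over the facet
    have hcone : ∀ b : Submodule.span ℝ P, IsLat (b : Fin n → ℝ) →
        (∃ c : V → ℝ, (∀ i, 0 ≤ c i) ∧ (∀ i, i ∉ T → c i = 0) ∧ b = ∑ i, c i • v i) →
        ∃ z : ℤ, φ b = z := by
      rintro b hb ⟨c, hc0, hcT, hbc⟩
      have hφb : φ b = ∑ i, c i := by
        rw [hbc, map_sum]
        apply Finset.sum_congr rfl
        intro i _
        rw [map_smul, smul_eq_mul]
        by_cases hi : i ∈ T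
        · have hi : φ (v i) = 1 := hi
          rw [hi, mul_one]
        · simp [hcT i hi]
      have hs0 : 0 ≤ ∑ i, c i := Finset.sum_nonneg fun i _ => hc0 i
      have hmem : (b : Fin n → ℝ) ∈ (∑ i, c i) • P :=
        (mem_smul_hull h0 hs0).mpr ⟨c, hc0, rfl, by rw [hbc, hcomb]⟩
      have hbcn : (b : Fin n → ℝ) ∈ cn P := ⟨_, hs0, hmem⟩
      have hL := gg_isLeast hK hc h0 hbcn
      have e1 := hL.2 ⟨hs0, hmem⟩
      have e2 := hbd φ hle _ hL.1.1 b hL.1.2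
      obtain ⟨z, hz⟩ := hI _ hbcn hb
      exact ⟨z, by linarith⟩
    -- interior lattice vector
    choose d hd hdl using fun i : V => exists_den (i : Fin n → ℝ) (hV i i.2)
    obtain ⟨c, hca⟩ : ∃ c : V → ℝ, (∀ i, i ∉ T → c i = 0) ∧ a = ∑ i, c i • v i := by
      have : a ∈ Submodule.span ℝ (v '' T) := by rw [hT]; trivial
      refine Submodule.span_induction (p := fun a _ => ∃ c : V → ℝ, (∀ i, i ∉ T → c i = 0) ∧ a = ∑ i, c i • v i) ?_ ?_ ?_ ?_ this
      · rintro _ ⟨j, hj, rfl⟩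
        refine ⟨Pi.single j 1, fun i hi => ?_, ?_⟩
        · rw [Pi.single_eq_of_ne]
          rintro rfl; exact hi hj
        · simp [Pi.single_apply]
      · exact ⟨0, by simp, by simp⟩
      · rintro x y _ _ ⟨c1, h1, rfl⟩ ⟨c2, h2, rfl⟩
        exact ⟨c1 + c2, fun i hi => by simp [h1 i hi, h2 i hi], by
          simp [add_smul, Finset.sum_add_distrib]⟩
      · rintro r x _ ⟨c1, h1, rfl⟩
        exact ⟨r • c1, fun i hi => by simp [h1 i hi], by simp [mul_smul, Finset.smul_sum]⟩
    obtain ⟨hcT, hca⟩ := hca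
    let N : V → ℝ := fun i => if i ∈ T then (⌈|c i|⌉ : ℝ) * d i else 0
    let w : Submodule.span ℝ P := ∑ i, N i • v i
    have hNn : ∀ i, 0 ≤ N i := by
      intro i
      simp only [N]
      split_ifs
      · have : (0:ℝ) ≤ ⌈|c i|⌉ := (abs_nonneg _).trans (Int.le_ceil _)
        positivity
      · rfl
    have hwl : IsLat (w : Fin n → ℝ) := by
      have : (w : Fin n → ℝ) = ∑ i, N i • (i : Fin n → ℝ) := hcomb N
      rw [this]
      apply Finset.sum_induction _ IsLat (fun _ _ => IsLat.add) (fun i => ⟨0, by simp⟩)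
      intro i _
      simp only [N]
      split_ifs
      · rw [mul_smul]
        exact (hdl i).zsmul _
      · exact fun i => ⟨0, by simp⟩
    obtain ⟨z1, hz1⟩ := hcone w hwl ⟨N, hNn, fun i hi => by simp [N, hi], rfl⟩
    obtain ⟨z2, hz2⟩ := hcone (a + w) (ha.add hwl) ⟨c + N, fun i => by
      by_cases hi : i ∈ T
      · simp only [Pi.add_apply, N, hi, if_true]
        have h1 : (|c i|:ℝ) ≤ ⌈|c i|⌉ := Int.le_ceil _
        have h2 : (1:ℝ) ≤ d i := by exact_mod_cast hd i
        have h3 := neg_abs_le (c i)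
        have h4 := abs_nonneg (c i)
        nlinarith
      · simp [N, hi, hcT i hi], fun i hi => by simp [N, hi, hcT i hi], by
        simp only [Pi.add_apply, add_smul, Finset.sum_add_distrib]
        rw [← hca]⟩
    refine ⟨z2 - z1, ?_⟩
    rw [map_add] at hz2
    push_cast
    linarith
theorem frac_exists (a : ℝ) (ha : ¬ ∃ z : ℤ, a = z) :
    ∃ j : ℕ, 0 < j ∧ 0 < Int.fract (j * a) ∧ Int.fract (j * a) ≤ 1 / 2 := by
  have hpos : 0 < Int.fract a := by
    apply lt_of_le_of_ne (Int.fract_nonneg a)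
    intro h
    exact ha ⟨⌊a⌋, by have := Int.self_sub_floor a; linarith⟩
  have hlt := Int.fract_lt_one a
  by_cases hh : Int.fract a ≤ 1 / 2
  · exact ⟨1, one_pos, by simpa using hpos, by simpa using hh⟩
  push Not at hh
  have hex : ∃ j : ℕ, 1 / 2 ≤ (j : ℝ) * (1 - Int.fract a) := by
    obtain ⟨j, hj⟩ := exists_nat_gt ((1 / 2) / (1 - Int.fract a))
    exact ⟨j, by rw [div_lt_iff₀ (by linarith)] at hj; exact hj.le⟩
  have h1 := Nat.find_spec hex
  set j := Nat.find hex with hj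
  have hj0 : 0 < j := by
    rcases Nat.eq_zero_or_pos j with h | h
    · rw [h] at h1; norm_num at h1
    · exact h
  have h2 : ¬ (1 / 2 ≤ ((j - 1 : ℕ) : ℝ) * (1 - Int.fract a)) := Nat.find_min hex (by omega)
  rw [Nat.cast_sub hj0] at h2
  push Not at h2
  push_cast at h2
  have hfr : Int.fract ((j : ℝ) * a) = 1 - j * (1 - Int.fract a) := by
    rw [Int.fract_eq_iff]
    refine ⟨by nlinarith, by linarith, j * ⌊a⌋ + j - 1, ?_⟩
    have := Int.self_sub_floor a
    push_cast
    rw [← this]; ring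
  refine ⟨j, hj0, ?_, ?_⟩
  · rw [hfr]; nlinarith
  · rw [hfr]; linarith

theorem mem_join {P Q : Set (Fin n → ℝ)} (hcP : Convex ℝ P) (hcQ : Convex ℝ Q)
    (hKP : IsCompact P) (hKQ : IsCompact Q)
    (h0P : (0 : Fin n → ℝ) ∈ P) (h0Q : (0 : Fin n → ℝ) ∈ Q)
    (hdis : ∀ x, x ∈ Submodule.span ℝ P → x ∈ Submodule.span ℝ Q → x = 0)
    {x y : Fin n → ℝ} (hx : x ∈ Submodule.span ℝ P) (hy : y ∈ Submodule.span ℝ Q)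
    {k : ℝ} (hk : 0 ≤ k) :
    x + y ∈ k • convexHull ℝ (P ∪ Q) ↔ x ∈ cn P ∧ y ∈ cn Q ∧ gg P x + gg Q y ≤ k := by
  constructor
  · rintro ⟨r, hr, hrxy⟩
    rw [hcP.convexHull_union hcQ ⟨0, h0P⟩ ⟨0, h0Q⟩, mem_convexJoin] at hr
    obtain ⟨p, hp, q, hq, a, b, ha, hb, hab, rfl⟩ := hr
    simp only [smul_add, smul_smul] at hrxy
    have e : x - (k * a) • p = (k * b) • q - y := by
      rw [sub_eq_sub_iff_add_eq_add, ← hrxy]; abel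
    have hz : x - (k * a) • p = 0 := by
      apply hdis
      · exact Submodule.sub_mem _ hx (Submodule.smul_mem _ _ (Submodule.subset_span hp))
      · rw [e]
        exact Submodule.sub_mem _ (Submodule.smul_mem _ _ (Submodule.subset_span hq)) hy
    have hxp : x = (k * a) • p := sub_eq_zero.mp hz
    have hyq : y = (k * b) • q := by rw [hz] at e; exact (sub_eq_zero.mp e.symm).symm
    have h1 := (mem_smul_iff hKP hcP h0P (mul_nonneg hk ha)).mp ⟨p, hp, hxp.symm⟩
    have h2 := (mem_smul_iff hKQ hcQ h0Q (mul_nonneg hk hb)).mp ⟨q, hq, hyq.symm⟩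
    refine ⟨h1.1, h2.1, ?_⟩
    have : k * a + k * b = k := by rw [← mul_add, hab, mul_one]
    linarith [h1.2, h2.2]
  · rintro ⟨hxc, hyc, hle⟩
    obtain ⟨⟨hg1, p, hp, hpx⟩, -⟩ := gg_isLeast hKP hcP h0P hxc
    obtain ⟨⟨hg2, q, hq, hqy⟩, -⟩ := gg_isLeast hKQ hcQ h0Q hyc
    have h0 : (0 : Fin n → ℝ) ∈ convexHull ℝ (P ∪ Q) := subset_convexHull ℝ _ (Or.inl h0P)
    have hcc := convex_convexHull ℝ (P ∪ Q)
    refine smul_mono' hcc h0 (add_nonneg hg1 hg2) hle ?_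
    rw [hcc.add_smul hg1 hg2]
    exact Set.add_mem_add ⟨p, subset_convexHull ℝ _ (Or.inl hp), hpx⟩
      ⟨q, subset_convexHull ℝ _ (Or.inr hq), hqy⟩

theorem ehr_eq {P : Set (Fin n → ℝ)} (h0 : (0 : Fin n → ℝ) ∈ P) (k : ℕ) :
    ehr P k = (latt ((k : ℝ) • P)).ncard := by
  unfold ehr
  split_ifs with h
  · subst h
    have : latt (((0 : ℕ) : ℝ) • P) = {0} := by
      ext x
      constructor
      · rintro ⟨⟨p, hp, rfl⟩, _⟩
        simp
      · rintro rfl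
        exact ⟨⟨0, h0, by simp⟩, fun i => ⟨0, by simp⟩⟩
    rw [this, Set.ncard_singleton]
  · rfl

theorem span_hull (S : Set (Fin n → ℝ)) :
    Submodule.span ℝ (convexHull ℝ S) = Submodule.span ℝ S := by
  apply le_antisymm
  · rw [Submodule.span_le]
    exact convexHull_min Submodule.subset_span (Submodule.convex _)
  · exact Submodule.span_mono (subset_convexHull ℝ S)

theorem cn_subset_span {P : Set (Fin n → ℝ)} {x : Fin n → ℝ} (hx : x ∈ cn P) :
    x ∈ Submodule.span ℝ P := by
  obtain ⟨l, hl, p, hp, rfl⟩ := hx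
  exact Submodule.smul_mem _ _ (Submodule.subset_span hp)

theorem latt_smul_eq {P : Set (Fin n → ℝ)} (hK : IsCompact P) (hc : Convex ℝ P)
    (h0 : (0 : Fin n → ℝ) ∈ P) (k : ℕ) :
    latt ((k : ℝ) • P) = {x | x ∈ latt (cn P) ∧ ⌈gg P x⌉₊ ≤ k} := by
  ext x
  simp only [latt, Set.mem_ofPred_eq, Nat.ceil_le]
  rw [mem_smul_iff hK hc h0 (Nat.cast_nonneg k)]
  tauto

theorem ceil_iff {P Q : Set (Fin n → ℝ)}
    (hcP : Convex ℝ P) (hcQ : Convex ℝ Q) (hKP : IsCompact P) (hKQ : IsCompact Q)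
    (h0P : (0 : Fin n → ℝ) ∈ P) (h0Q : (0 : Fin n → ℝ) ∈ Q) :
    (∀ x ∈ latt (cn P), ∀ y ∈ latt (cn Q),
      ⌈gg P x⌉₊ + ⌈gg Q y⌉₊ ≤ ⌈gg P x + gg Q y⌉₊) ↔
    ((∀ x ∈ cn P, IsLat x → ∃ z : ℤ, gg P x = z) ∨
      (∀ x ∈ cn Q, IsLat x → ∃ z : ℤ, gg Q x = z)) := by
  have natz : ∀ g : ℝ, 0 ≤ g → (∃ z : ℤ, g = z) → ∃ m : ℕ, g = m := by
    rintro g hg ⟨z, rfl⟩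
    have : 0 ≤ z := by exact_mod_cast hg
    lift z to ℕ using this
    exact ⟨z, by simp⟩
  constructor
  · intro h
    by_contra! hcon
    obtain ⟨⟨x, hx, hxl, hxn⟩, ⟨y, hy, hyl, hyn⟩⟩ := hcon
    obtain ⟨i, hi0, hi1, hi2⟩ := frac_exists (gg P x) (fun ⟨z, hz⟩ => hxn z hz)
    obtain ⟨j, hj0, hj1, hj2⟩ := frac_exists (gg Q y) (fun ⟨z, hz⟩ => hyn z hz)
    have hi0' : (0 : ℝ) < i := by exact_mod_cast hi0
    have hj0' : (0 : ℝ) < j := by exact_mod_cast hj0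
    have := h ((i : ℝ) • x) ⟨cn_smul hx hi0'.le, by exact_mod_cast hxl.zsmul i⟩
      ((j : ℝ) • y) ⟨cn_smul hy hj0'.le, by exact_mod_cast hyl.zsmul j⟩
    rw [gg_smul hKP hcP h0P hx hi0', gg_smul hKQ hcQ h0Q hy hj0'] at this
    have hu0 : 0 ≤ (i : ℝ) * gg P x := mul_nonneg hi0'.le (gg_nonneg x)
    have hv0 : 0 ≤ (j : ℝ) * gg Q y := mul_nonneg hj0'.le (gg_nonneg y)
    generalize (i : ℝ) * gg P x = u at *
    generalize (j : ℝ) * gg Q y = w at *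
    have hfu : (⌊u⌋₊ : ℝ) + Int.fract u = u := by
      rw [natCast_floor_eq_intCast_floor hu0]; exact Int.floor_add_fract u
    have hfw : (⌊w⌋₊ : ℝ) + Int.fract w = w := by
      rw [natCast_floor_eq_intCast_floor hv0]; exact Int.floor_add_fract w
    have c1 : ⌊u⌋₊ < ⌈u⌉₊ := Nat.lt_ceil.mpr (by linarith)
    have c2 : ⌊w⌋₊ < ⌈w⌉₊ := Nat.lt_ceil.mpr (by linarith)
    have c3 : ⌈u + w⌉₊ ≤ ⌊u⌋₊ + ⌊w⌋₊ + 1 := Nat.ceil_le.mpr (by push_cast; linarith)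
    omega
  · rintro (h | h) x ⟨hx, hxl⟩ y ⟨hy, hyl⟩
    · obtain ⟨m, hm⟩ := natz _ (gg_nonneg x) (h x hx hxl)
      rw [hm, Nat.ceil_natCast, add_comm (m : ℝ), Nat.ceil_add_natCast (gg_nonneg y)]
      omega
    · obtain ⟨m, hm⟩ := natz _ (gg_nonneg y) (h y hy hyl)
      rw [hm, Nat.ceil_natCast, Nat.ceil_add_natCast (gg_nonneg x)]

/-- Theorem 1.4 (characterization of the Ehrhart-series Braun equation). -/
theorem braun_ehrhart_iff {n : ℕ} (hn : 1 ≤ n) (P Q : Set (Fin n → ℝ))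
    (hP : IsRatPolytope P) (hQ : IsRatPolytope Q) (hfree : IsFreeSum P Q) :
    (∀ k : ℕ,
        (ehr (convexHull ℝ (P ∪ Q)) k : ℤ) =
          (∑ i ∈ Finset.range (k + 1), (ehr P i : ℤ) * (ehr Q (k - i) : ℤ)) -
            ∑ i ∈ Finset.range k, (ehr P i : ℤ) * (ehr Q (k - 1 - i) : ℤ)) ↔
      (DualIsLatticePolyhedron P ∨ DualIsLatticePolyhedron Q) := by
  obtain ⟨h0P, h0Q, hfr⟩ := id hfree
  rw [int_iff hP h0P, int_iff hQ h0Q]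
  obtain ⟨VP, hVP, hPV⟩ := hP
  obtain ⟨VQ, hVQ, hQV⟩ := hQ
  have hcP : Convex ℝ P := by rw [hPV]; exact convex_convexHull ℝ _
  have hcQ : Convex ℝ Q := by rw [hQV]; exact convex_convexHull ℝ _
  have hKP : IsCompact P := by
    rw [hPV]; exact VP.finite_toSet.isCompact_convexHull (𝕜 := ℝ)
  have hKQ : IsCompact Q := by
    rw [hQV]; exact VQ.finite_toSet.isCompact_convexHull (𝕜 := ℝ)
  have hdis : ∀ x, x ∈ Submodule.span ℝ P → x ∈ Submodule.span ℝ Q → x = 0 := fun x h1 h2 =>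
    span_disjoint (VP := VP) (VQ := VQ) hVP hVQ (by rw [hPV, span_hull]) (by rw [hQV, span_hull])
      hfree h1 h2
  rw [← ceil_iff hcP hcQ hKP hKQ h0P h0Q]
  have hfinP : ∀ k : ℕ, {x | x ∈ latt (cn P) ∧ ⌈gg P x⌉₊ ≤ k}.Finite := fun k => by
    rw [← latt_smul_eq hKP hcP h0P]; exact latt_finite (hKP.smul (k : ℝ)).isBounded
  have hfinQ : ∀ k : ℕ, {x | x ∈ latt (cn Q) ∧ ⌈gg Q x⌉₊ ≤ k}.Finite := fun k => by
    rw [← latt_smul_eq hKQ hcQ h0Q]; exact latt_finite (hKQ.smul (k : ℝ)).isBounded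
  have hehP : ∀ k, ehr P k = {x | x ∈ latt (cn P) ∧ ⌈gg P x⌉₊ ≤ k}.ncard := fun k => by
    rw [ehr_eq h0P, latt_smul_eq hKP hcP h0P]
  have hehQ : ∀ k, ehr Q k = {x | x ∈ latt (cn Q) ∧ ⌈gg Q x⌉₊ ≤ k}.ncard := fun k => by
    rw [ehr_eq h0Q, latt_smul_eq hKQ hcQ h0Q]
  let F : ℕ → Set ((Fin n → ℝ) × (Fin n → ℝ)) := fun k =>
    {q | q.1 ∈ latt (cn P) ∧ q.2 ∈ latt (cn Q) ∧ ⌈gg P q.1 + gg Q q.2⌉₊ ≤ k}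
  let G : ℕ → Set ((Fin n → ℝ) × (Fin n → ℝ)) := fun k =>
    {q | q.1 ∈ latt (cn P) ∧ q.2 ∈ latt (cn Q) ∧ ⌈gg P q.1⌉₊ + ⌈gg Q q.2⌉₊ ≤ k}
  have hGF : ∀ k, G k ⊆ F k := by
    rintro k q ⟨h1, h2, h3⟩
    exact ⟨h1, h2, (Nat.ceil_add_le _ _).trans h3⟩
  have hFfin : ∀ k, (F k).Finite := by
    intro k
    refine ((hfinP k).prod (hfinQ k)).subset ?_
    rintro q ⟨h1, h2, h3⟩
    refine ⟨⟨h1, (Nat.ceil_le_ceil ?_).trans h3⟩, ⟨h2, (Nat.ceil_le_ceil ?_).trans h3⟩⟩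
    · linarith [gg_nonneg (P := Q) q.2]
    · linarith [gg_nonneg (P := P) q.1]
  have hehPQ : ∀ k, ehr (convexHull ℝ (P ∪ Q)) k = (F k).ncard := by
    intro k
    rw [ehr_eq (subset_convexHull ℝ _ (Or.inl h0P))]
    symm
    refine Set.ncard_congr (fun q _ => q.1 + q.2) ?_ ?_ ?_
    · rintro ⟨x, y⟩ ⟨⟨h1, h1l⟩, ⟨h2, h2l⟩, h3⟩
      refine ⟨?_, h1l.add h2l⟩
      exact (mem_join hcP hcQ hKP hKQ h0P h0Q hdis (cn_subset_span h1) (cn_subset_span h2)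
        (Nat.cast_nonneg k)).mpr ⟨h1, h2, Nat.ceil_le.mp h3⟩
    · rintro ⟨x, y⟩ ⟨x', y'⟩ ⟨⟨h1, _⟩, ⟨h2, _⟩, _⟩ ⟨⟨h1', _⟩, ⟨h2', _⟩, _⟩ he
      simp only at h1 h2 h1' h2' he
      have e : x - x' = y' - y := by
        rw [sub_eq_sub_iff_add_eq_add, he]; abel
      have hz : x - x' = 0 := by
        apply hdis
        · exact Submodule.sub_mem _ (cn_subset_span h1) (cn_subset_span h1')
        · rw [e]
          exact Submodule.sub_mem _ (cn_subset_span h2') (cn_subset_span h2)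
      rw [hz] at e
      rw [sub_eq_zero.mp hz, sub_eq_zero.mp e.symm]
    · rintro m ⟨hm, hml⟩
      have hms : m ∈ Submodule.span ℝ (P ∪ Q) := by
        obtain ⟨p, hp, rfl⟩ := hm
        rw [← span_hull]
        exact Submodule.smul_mem _ _ (Submodule.subset_span hp)
      obtain ⟨⟨x, y⟩, ⟨⟨hx, hxl⟩, ⟨hy, hyl⟩, rfl⟩, -⟩ := hfr m hms hml
      obtain ⟨g1, g2, g3⟩ := (mem_join hcP hcQ hKP hKQ h0P h0Q hdis hx hy
        (Nat.cast_nonneg k)).mp hm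
      exact ⟨(x, y), ⟨⟨g1, hxl⟩, ⟨g2, hyl⟩, Nat.ceil_le.mpr g3⟩, rfl⟩
  have hmain : (∀ k : ℕ, (ehr (convexHull ℝ (P ∪ Q)) k : ℤ) =
          (∑ i ∈ Finset.range (k + 1), (ehr P i : ℤ) * (ehr Q (k - i) : ℤ)) -
            ∑ i ∈ Finset.range k, (ehr P i : ℤ) * (ehr Q (k - 1 - i) : ℤ)) ↔
      ∀ k, F k ⊆ G k := by
    apply forall_congr'
    intro k
    simp only [hehP, hehQ, hehPQ]
    rw [← count_eq _ _ _ _ hfinP hfinQ k]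
    change ((F k).ncard : ℤ) = ((G k).ncard : ℤ) ↔ _
    constructor
    · intro h
      have h : (F k).ncard = (G k).ncard := by exact_mod_cast h
      exact (Set.eq_of_subset_of_ncard_le (hGF k) h.le (hFfin k)).ge
    · intro h
      rw [subset_antisymm h (hGF k)]
  rw [hmain]
  constructor
  · intro h x hx y hy
    exact (h ⌈gg P x + gg Q y⌉₊ (show (x, y) ∈ F _ from ⟨hx, hy, le_rfl⟩)).2.2
  · rintro h k q ⟨h1, h2, h3⟩
    exact ⟨h1, h2, (h _ h1 _ h2).trans h3⟩

end ArxivFreeSum
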